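/- arXiv:2603.15494 — 3 statements merged into one kernel-verified Lean document; each statement's English description precedes it below -/
import Mathlib

section
/- Let M ∈ Sym_d have distinct eigenvalues λ_1 > ⋯ > λ_{d'} > 0 > λ_{d'+1} > ⋯ > λ_d with unit eigenvectors u_1,…,u_d, and let f(x) = (1/4)‖xx^⊤ - M‖_F². Then the set of critical points of f is {0} ∪ {±√(λ_i) u_i : i = 1,…,d'}, and at every critical point x̄ of f, every eigenvalue of ∇²f(x̄) has absolute value at least μ := min(λ_1 - λ_2, …, λ_{d'-1} - λ_{d'}, λ_{d'}, -λ_{d'+1}, λ_{d'+1} - λ_{d'+2}, …, λ_{d-1} - λ_d). -/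
open Matrix

theorem exists_dotProduct_ne_zero_of_orthonormal {d : ℕ} {u : ℕ → Fin d → ℝ}
    (hunit : ∀ i < d, u i ⬝ᵥ u i = 1) (horth : ∀ i < d, ∀ j < d, i ≠ j → u i ⬝ᵥ u j = 0)
    {v : Fin d → ℝ} (hv : v ≠ 0) : ∃ j < d, u j ⬝ᵥ v ≠ 0 := by
  by_contra! h
  let U : Matrix (Fin d) (Fin d) ℝ := Matrix.of fun i => u i
  have hU : U * Uᵀ = 1 := by
    ext i j
    change u i ⬝ᵥ u j = _
    rcases eq_or_ne i j with rfl | hij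
    · simpa using hunit i i.2
    · rw [Matrix.one_apply_ne hij]
      exact horth i i.2 j j.2 (Fin.val_ne_of_ne hij)
  have hU0 : U *ᵥ v = 0 := by
    ext i
    exact h i i.2
  apply hv
  rw [← Matrix.one_mulVec v, ← mul_eq_one_comm.mp hU, ← Matrix.mulVec_mulVec, hU0,
    Matrix.mulVec_zero]

theorem Matrix.IsSymm.dotProduct_mulVec_of_eigenvector {n : Type*} [Fintype n]
    {M : Matrix n n ℝ} (hM : M.IsSymm) {w : n → ℝ} {c : ℝ} (hw : M *ᵥ w = c • w) (v : n → ℝ) :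
    w ⬝ᵥ M *ᵥ v = c * (w ⬝ᵥ v) := by
  rw [Matrix.dotProduct_mulVec, ← Matrix.mulVec_transpose, hM.eq, hw, smul_dotProduct, smul_eq_mul]

theorem le_abs_sub_of_le_sub_succ {d : ℕ} {ν : ℕ → ℝ} {μ : ℝ}
    (hstep : ∀ i < d, 0 ≤ ν i - ν (i + 1)) (hμ : ∀ i < d, μ ≤ ν i - ν (i + 1))
    {a b : ℕ} (ha : a ≤ d) (hb : b ≤ d) (hab : a ≠ b) : μ ≤ |ν a - ν b| := by
  have key : ∀ a b, a < b → b ≤ d → μ ≤ ν a - ν b := by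
    intro a b hlt
    induction b, hlt using Nat.le_induction with
    | base => exact hμ a
    | succ b _ ih =>
      intro hbd
      linarith [ih (by omega), hstep b (by omega)]
  rcases lt_or_gt_of_ne hab with h | h
  · exact (key a b h hb).trans (le_abs_self _)
  · rw [abs_sub_comm]
    exact (key b a h ha).trans (le_abs_self _)

/-- The rank-one matrix approximation cost `f(x) = ¼‖xxᵀ - M‖_F²` is `μ`-Morse
(Lemma `mu_morse_example`). The eigenvalues `lam 0 > ⋯ > lam (d-1)` of the symmetric
matrix `M` are distinct, the first `d'` are positive and the rest negative.
The gradient of `f` is `(xxᵀ - M)x` and its Hessian is `‖x‖²I + 2xxᵀ - M`.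
The constant μ is the minimum of the consecutive gaps of the sequence
`lam 0, …, lam (d'-1), 0, lam d', …, lam (d-1)` (encoded by `ν`). -/
theorem rank_one_matrix_factorization_is_mu_morse
    {d d' : ℕ} (hd : 0 < d) (hd' : d' ≤ d)
    (M : Matrix (Fin d) (Fin d) ℝ) (hM : M.IsSymm)
    (lam : ℕ → ℝ) (u : ℕ → Fin d → ℝ)
    (heig : ∀ i < d, M.mulVec (u i) = lam i • u i)
    (hunit : ∀ i < d, u i ⬝ᵥ u i = 1)
    (hdec : ∀ i j, i < j → j < d → lam j < lam i)
    (hpos : ∀ i < d', 0 < lam i)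
    (hneg : ∀ i, d' ≤ i → i < d → lam i < 0)
    (ν : ℕ → ℝ)
    (hν : ∀ i, ν i = if i < d' then lam i else if i = d' then 0 else lam (i - 1))
    (μ : ℝ) (hμ : μ = sInf {r : ℝ | ∃ i < d, r = ν i - ν (i + 1)})
    (gradF : (Fin d → ℝ) → Fin d → ℝ)
    (hgrad : ∀ x, gradF x = (vecMulVec x x - M).mulVec x)
    (hessF : (Fin d → ℝ) → Matrix (Fin d) (Fin d) ℝ)
    (hhess : ∀ x, hessF x =
      (x ⬝ᵥ x) • (1 : Matrix (Fin d) (Fin d) ℝ) + (2 : ℝ) • vecMulVec x x - M) :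
    ({x : Fin d → ℝ | gradF x = 0}
        = {0} ∪ {x : Fin d → ℝ | ∃ i < d',
            x = Real.sqrt (lam i) • u i ∨ x = -(Real.sqrt (lam i) • u i)}) ∧
    (∀ xbar : Fin d → ℝ, gradF xbar = 0 →
      ∀ (ρ : ℝ) (v : Fin d → ℝ), v ≠ 0 → (hessF xbar).mulVec v = ρ • v → μ ≤ |ρ|) := by
  have hne : ∀ i < d, ∀ j < d, i ≠ j → lam i ≠ lam j := by
    intro i hi j hj hij
    rcases lt_or_gt_of_ne hij with h | h
    · exact (hdec i j h hj).ne'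
    · exact (hdec j i h hi).ne
  have horth : ∀ i < d, ∀ j < d, i ≠ j → u i ⬝ᵥ u j = 0 := by
    intro i hi j hj hij
    have h := hM.dotProduct_mulVec_of_eigenvector (heig i hi) (u j)
    rw [heig j hj, dotProduct_smul, smul_eq_mul] at h
    exact (mul_eq_mul_right_iff.mp h.symm).resolve_left (hne i hi j hj hij)
  have hcoef := @exists_dotProduct_ne_zero_of_orthonormal d u hunit horth
  have hgrad' : ∀ x, gradF x = (x ⬝ᵥ x) • x - M *ᵥ x := by
    intro x
    rw [hgrad, Matrix.sub_mulVec, vecMulVec_mulVec]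
    simp
  have hcrit : {x : Fin d → ℝ | gradF x = 0}
      = {0} ∪ {x : Fin d → ℝ | ∃ i < d',
          x = Real.sqrt (lam i) • u i ∨ x = -(Real.sqrt (lam i) • u i)} := by
    ext x
    simp only [Set.mem_ofPred_eq, Set.mem_union, Set.mem_singleton_iff, hgrad', sub_eq_zero]
    constructor
    · intro hx
      refine or_iff_not_imp_left.mpr fun hx0 => ?_
      have hc : ∀ j < d, (x ⬝ᵥ x) * (u j ⬝ᵥ x) = lam j * (u j ⬝ᵥ x) := by
        intro j hj
        rw [← hM.dotProduct_mulVec_of_eigenvector (heig j hj), ← hx, dotProduct_smul, smul_eq_mul]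
      obtain ⟨i, hi, hci⟩ := hcoef hx0
      have hs : x ⬝ᵥ x = lam i := mul_right_cancel₀ hci (hc i hi)
      have hxu : x = (u i ⬝ᵥ x) • u i := by
        by_contra hxne
        obtain ⟨j, hj, hcj⟩ := hcoef (sub_ne_zero.mpr hxne)
        apply hcj
        rw [dotProduct_sub, dotProduct_smul, smul_eq_mul]
        rcases eq_or_ne i j with rfl | hij
        · rw [hunit i hi]; ring
        · rw [horth j hj i hi hij.symm, mul_zero, sub_zero]
          have h := hc j hj
          rw [hs] at h
          exact (mul_eq_mul_right_iff.mp h).resolve_left (hne i hi j hj hij)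
      have hsq : (u i ⬝ᵥ x) ^ 2 = lam i := by
        rw [← hs]
        conv_rhs => rw [hxu]
        rw [smul_dotProduct, smul_eq_mul, sq]
        simp [dotProduct_smul, hunit i hi]
      have hid : i < d' := by
        by_contra hge
        linarith [hneg i (by omega) hi, sq_nonneg (u i ⬝ᵥ x)]
      refine ⟨i, hid, ?_⟩
      rw [← hsq, Real.sqrt_sq_eq_abs, ← neg_smul]
      rcases abs_choice (u i ⬝ᵥ x) with h | h <;> rw [h]
      · exact Or.inl hxu
      · rw [neg_neg]
        exact Or.inr hxu
    · rintro (rfl | ⟨i, hi, rfl | rfl⟩)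
      · simp
      all_goals
        simp [Matrix.mulVec_smul, Matrix.mulVec_neg, heig i (hi.trans_le hd'),
          hunit i (hi.trans_le hd'), dotProduct_smul, smul_dotProduct, smul_smul,
          Real.mul_self_sqrt (hpos i hi).le, mul_comm]
  refine ⟨hcrit, ?_⟩
  have hνlt : ∀ i < d', ν i = lam i := fun i hi => by rw [hν, if_pos hi]
  have hνd : ν d' = 0 := by simp [hν]
  have hνgt : ∀ i, d' ≤ i → ν (i + 1) = lam i := fun i hi => by
    rw [hν, if_neg (by omega), if_neg (by omega), Nat.add_sub_cancel]
  have hstep : ∀ i < d, 0 ≤ ν i - ν (i + 1) := by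
    intro i hi
    rcases lt_trichotomy i d' with h | rfl | h
    · rw [hνlt i h]
      rcases (Nat.succ_le_of_lt h).eq_or_lt with h' | h'
      · rw [show i + 1 = d' from h', hνd]
        linarith [hpos i h]
      · rw [hνlt (i + 1) h']
        linarith [hdec i (i + 1) (by omega) (by omega)]
    · rw [hνd, hνgt i le_rfl]
      linarith [hneg i le_rfl hi]
    · obtain ⟨k, rfl⟩ : ∃ k, i = k + 1 := ⟨i - 1, by omega⟩
      rw [hνgt k (by omega), hνgt (k + 1) (by omega)]
      linarith [hdec k (k + 1) (by omega) hi]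
  have hμle : ∀ i < d, μ ≤ ν i - ν (i + 1) := by
    intro i hi
    rw [hμ]
    refine csInf_le ⟨0, ?_⟩ ⟨i, hi, rfl⟩
    rintro r ⟨k, hk, rfl⟩
    exact hstep k hk
  have hembed : ∀ j < d, ∃ a ≤ d, a ≠ d' ∧ ν a = lam j ∧ (a = j ∧ j < d' ∨ a = j + 1 ∧ d' ≤ j) := by
    intro j hj
    rcases lt_or_ge j d' with h | h
    · exact ⟨j, hj.le, h.ne, hνlt j h, Or.inl ⟨rfl, h⟩⟩
    · exact ⟨j + 1, hj, by omega, hνgt j h, Or.inr ⟨rfl, h⟩⟩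
  have hlam : ∀ j < d, μ ≤ |lam j| := by
    intro j hj
    obtain ⟨a, ha, had, hνa, -⟩ := hembed j hj
    have h := le_abs_sub_of_le_sub_succ hstep hμle ha hd' had
    rwa [hνa, hνd, sub_zero] at h
  have hgap : ∀ i < d, ∀ j < d, i ≠ j → μ ≤ |lam i - lam j| := by
    intro i hi j hj hij
    obtain ⟨a, ha, -, hνa, ha'⟩ := hembed i hi
    obtain ⟨b, hb, -, hνb, hb'⟩ := hembed j hj
    have h := le_abs_sub_of_le_sub_succ hstep hμle ha hb (by omega)
    rwa [hνa, hνb] at h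
  intro x hx ρ v hv hρ
  obtain ⟨j, hj, hcj⟩ := hcoef hv
  have hquad : (x ⬝ᵥ x) * (u j ⬝ᵥ v) + 2 * ((x ⬝ᵥ v) * (u j ⬝ᵥ x)) - lam j * (u j ⬝ᵥ v)
      = ρ * (u j ⬝ᵥ v) := by
    have h := congrArg (fun w => u j ⬝ᵥ w) hρ
    simpa [hhess, Matrix.sub_mulVec, Matrix.add_mulVec, Matrix.smul_mulVec, vecMulVec_mulVec,
      dotProduct_sub, dotProduct_add, dotProduct_smul,
      hM.dotProduct_mulVec_of_eigenvector (heig j hj)] using h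
  have hx' : x ∈ {x : Fin d → ℝ | gradF x = 0} := hx
  rw [hcrit] at hx'
  rcases hx' with h0 | ⟨i, hi, hxi⟩
  · rw [Set.mem_singleton_iff.mp h0] at hquad
    have hρj : ρ = -lam j := mul_right_cancel₀ hcj (by simpa using hquad.symm)
    rw [hρj, abs_neg]
    exact hlam j hj
  · have hid := hi.trans_le hd'
    have hsqrt := Real.mul_self_sqrt (hpos i hi).le
    have hxx : x ⬝ᵥ x = lam i := by
      rcases hxi with rfl | rfl <;>
        simp [dotProduct_smul, smul_dotProduct, hunit i hid, hsqrt]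
    have hcross : (x ⬝ᵥ v) * (u j ⬝ᵥ x) = lam i * ((u i ⬝ᵥ v) * (u j ⬝ᵥ u i)) := by
      rw [← hsqrt]
      rcases hxi with rfl | rfl <;>
        simp [dotProduct_smul, smul_dotProduct] <;> ring
    rw [hxx, hcross] at hquad
    rcases eq_or_ne i j with rfl | hij
    · rw [hunit i hid] at hquad
      have hρj : ρ = 2 * lam i := mul_right_cancel₀ hcj (by linarith)
      have h := hlam i hid
      rw [abs_of_pos (hpos i hi)] at h
      rw [hρj]
      exact (by linarith [hpos i hi] : μ ≤ 2 * lam i).trans (le_abs_self _)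
    · rw [horth j hj i hid hij.symm] at hquad
      have hρj : ρ = lam i - lam j := mul_right_cancel₀ hcj (by linarith)
      rw [hρj]
      exact hgap i hid j hj hij
end

section
/- Consider the conjugate gradient iteration on the quadratic m(v) = ⟨g,v⟩ + (1/2)⟨v,Hv⟩ with symmetric H, ‖H‖_op ≤ L_G, started at v^(0), with residuals r^(t) = -(Hv^(t)+g), directions p^(t) = r^(t) + β^(t)p^(t-1) with β^(t) = ‖r^(t)‖²/‖r^(t-1)‖² ≥ 0, and steps v^(t) = v^(t-1) + α^(t)p^(t-1) with α^(t) = ‖r^(t-1)‖²/⟨p^(t-1),Hp^(t-1)⟩ ≥ 1/L_G. Let q be a unit eigenvector of H with eigenvalue λ < 0, and v̄ = -H⁺g (pseudoinverse). Then for every t (while the iteration runs without detecting nonpositive curvature), |⟨v^(t) - v̄, q⟩| ≥ (1 + |λ|/L_G)^t · |⟨v^(0) - v̄, q⟩|. -/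
open RealInnerProductSpace

/-- Geometric growth for a coupled recursion `x ↦ x + α c`, `c ↦ μ x + β c` with nonnegative
initial value, `c 0 = μ x 0`, step sizes `α` bounded below by `a ≥ 0` and `β ≥ 0`. -/
theorem geometric_growth_of_coupled_recursion {N : ℕ} {x c α β : ℕ → ℝ} {μ a : ℝ}
    (hμ : 0 ≤ μ) (ha : 0 ≤ a) (hx0 : 0 ≤ x 0) (hc0 : c 0 = μ * x 0)
    (hx : ∀ t, t + 1 ≤ N → x (t + 1) = x t + α (t + 1) * c t)
    (hc : ∀ t, t + 1 ≤ N → c (t + 1) = μ * x (t + 1) + β (t + 1) * c t)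
    (hα : ∀ t, t + 1 ≤ N → a ≤ α (t + 1)) (hβ : ∀ t, t + 1 ≤ N → 0 ≤ β (t + 1)) :
    ∀ t ≤ N, (1 + μ * a) ^ t * x 0 ≤ x t ∧ μ * x t ≤ c t := by
  intro t
  induction t with
  | zero => intro _; simp [hc0]
  | succ t ih =>
    intro ht
    obtain ⟨hxt, hct⟩ := ih (by omega)
    have hxt_nonneg : 0 ≤ x t := le_trans (by positivity) hxt
    have hct_nonneg : 0 ≤ c t := le_trans (by positivity) hct
    constructor
    · calc (1 + μ * a) ^ (t + 1) * x 0 = (1 + μ * a) * ((1 + μ * a) ^ t * x 0) := by ring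
        _ ≤ (1 + μ * a) * x t := by gcongr
        _ = x t + a * (μ * x t) := by ring
        _ ≤ x t + α (t + 1) * c t := by
          gcongr
          · exact ha.trans (hα t ht)
          · exact hα t ht
        _ = x (t + 1) := (hx t ht).symm
    · rw [hc t ht]
      exact le_add_of_nonneg_right (mul_nonneg (hβ t ht) hct_nonneg)

/-- Divergence of conjugate gradients along a negative curvature direction
(Proposition `vt_qi_growth`): the component of `v^(t) - v̄` along a unit eigenvector `q`
of `H` with eigenvalue `λ < 0` grows at least like `(1 + |λ|/L_G)^t`.
Here `v̄ = -H⁺g` is characterized by `H(H v̄) = -(H g)` (true of the Moore–Penrose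
pseudoinverse; any such `v̄` has the same component along `q` since `q ∈ range H`). -/
theorem cg_divergence_along_negative_curvature
    {d : ℕ} (H : EuclideanSpace ℝ (Fin d) →L[ℝ] EuclideanSpace ℝ (Fin d))
    (hsymm : ∀ a b, ⟪H a, b⟫ = ⟪a, H b⟫)
    (L_G : ℝ) (hL : 0 < L_G) (hH : ‖H‖ ≤ L_G)
    (g : EuclideanSpace ℝ (Fin d))
    (lam : ℝ) (hlam : lam < 0)
    (q : EuclideanSpace ℝ (Fin d)) (hq : H q = lam • q) (hqnorm : ‖q‖ = 1)
    (vbar : EuclideanSpace ℝ (Fin d)) (hvbar : H (H vbar) = -(H g))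
    (N : ℕ)
    (v r p : ℕ → EuclideanSpace ℝ (Fin d)) (α β : ℕ → ℝ)
    (hr : ∀ t ≤ N, r t = -(H (v t) + g))
    (hp0 : p 0 = r 0)
    (hp : ∀ t, t + 1 ≤ N → p (t + 1) = r (t + 1) + β (t + 1) • p t)
    (hβ : ∀ t, t + 1 ≤ N → β (t + 1) = ‖r (t + 1)‖ ^ 2 / ‖r t‖ ^ 2)
    (hv : ∀ t, t + 1 ≤ N → v (t + 1) = v t + α (t + 1) • p t)
    (hα : ∀ t, t + 1 ≤ N → α (t + 1) = ‖r t‖ ^ 2 / ⟪p t, H (p t)⟫)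
    (hαlb : ∀ t, t + 1 ≤ N → 1 / L_G ≤ α (t + 1))
    (hcurv : ∀ t, t + 1 ≤ N → 0 < ⟪p t, H (p t)⟫) :
    ∀ t ≤ N, (1 + |lam| / L_G) ^ t * |⟪v 0 - vbar, q⟫| ≤ |⟪v t - vbar, q⟫| := by
  have hvbar_q : ⟪H vbar + g, q⟫ = 0 := by
    have h : lam * ⟪H vbar + g, q⟫ = 0 := by
      rw [← real_inner_smul_right, ← hq, ← hsymm, map_add, hvbar, neg_add_cancel, inner_zero_left]
    exact (mul_eq_zero.mp h).resolve_left hlam.ne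
  have hr_q : ∀ t ≤ N, ⟪r t, q⟫ = |lam| * ⟪v t - vbar, q⟫ := by
    intro t ht
    have hsplit : r t = -(H (v t - vbar)) - (H vbar + g) := by
      rw [hr t ht, map_sub]; abel
    rw [hsplit, inner_sub_left, hvbar_q, inner_neg_left, hsymm, hq, real_inner_smul_right,
      abs_of_neg hlam]
    ring
  obtain ⟨s, hs, hs0⟩ : ∃ s : ℝ, |s| = 1 ∧ s * ⟪v 0 - vbar, q⟫ = |⟪v 0 - vbar, q⟫| := by
    rcases abs_cases ⟪v 0 - vbar, q⟫ with ⟨h, -⟩ | ⟨h, -⟩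
    · exact ⟨1, by simp, by rw [h, one_mul]⟩
    · exact ⟨-1, by simp, by rw [h, neg_one_mul]⟩
  intro t ht
  have hgrowth := (geometric_growth_of_coupled_recursion (N := N) (α := α) (β := β)
    (x := fun t => s * ⟪v t - vbar, q⟫) (c := fun t => s * ⟪p t, q⟫) (a := 1 / L_G)
    (abs_nonneg lam) (by positivity) (hs0 ▸ abs_nonneg _)
    (by simp only [hp0, hr_q 0 N.zero_le]; ring)
    (fun t ht => by
      simp only [hv t ht, add_sub_right_comm, inner_add_left, real_inner_smul_left]; ring)
    (fun t ht => by
      simp only [hp t ht, inner_add_left, real_inner_smul_left, hr_q (t + 1) ht]; ring)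
    hαlb (fun t ht => by rw [hβ t ht]; positivity) t ht).1
  calc (1 + |lam| / L_G) ^ t * |⟪v 0 - vbar, q⟫|
      = (1 + |lam| * (1 / L_G)) ^ t * (s * ⟪v 0 - vbar, q⟫) := by rw [hs0, mul_one_div]
    _ ≤ s * ⟪v t - vbar, q⟫ := hgrowth
    _ ≤ |s * ⟪v t - vbar, q⟫| := le_abs_self _
    _ = |⟪v t - vbar, q⟫| := by rw [abs_mul, hs, one_mul]
end

section
/- Let d ≥ 3, z ∈ ℝ^d, c ∈ ℝ, δ ∈ (0,1), and σ > 0. Let ξ = σ·e·ξ̄ where ξ̄ is uniform on the unit sphere of ℝ^d and e ∈ {±1} is arbitrary (possibly depending on ξ̄). Then ℙ( |⟨z, ξ⟩ + c| ≥ δ‖z‖σ√(π/(8d)) ) ≥ 1 - δ. -/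
open MeasureTheory RealInnerProductSpace

lemma integrable_sq_mul_exp_neg {c : ℝ} (hc : 0 < c) :
    Integrable fun x : ℝ ↦ x ^ 2 * Real.exp (-(c / 2) * x ^ 2) := by
  simpa using integrable_rpow_mul_exp_neg_mul_sq (b := c / 2) (by positivity) (s := 2) (by norm_num)

lemma integral_sq_mul_exp_neg {c : ℝ} (hc : 0 < c) :
    ∫ x : ℝ, x ^ 2 * Real.exp (-(c / 2) * x ^ 2) = √(2 * Real.pi / c) / c := by
  let v : NNReal := ⟨c⁻¹, by positivity⟩
  have hv : v ≠ 0 := by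
    intro h
    have : c⁻¹ = 0 := congrArg NNReal.toReal h
    exact hc.ne' (inv_eq_zero.mp this)
  have hvc : (v : ℝ) = c⁻¹ := rfl
  have h1 : ∫ x, x ^ 2 ∂(ProbabilityTheory.gaussianReal 0 v) = c⁻¹ := by
    have := ProbabilityTheory.variance_id_gaussianReal (μ := 0) (v := v)
    rw [ProbabilityTheory.variance_eq_integral (by fun_prop)] at this
    rw [← hvc]
    simpa [ProbabilityTheory.integral_id_gaussianReal] using this
  rw [ProbabilityTheory.integral_gaussianReal_eq_integral_smul hv] at h1
  simp only [ProbabilityTheory.gaussianPDFReal, hvc, sub_zero, smul_eq_mul] at h1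
  have h2 : ∀ x : ℝ, (√(2 * Real.pi * c⁻¹))⁻¹ * Real.exp (-x ^ 2 / (2 * c⁻¹)) * x ^ 2 =
      (√(2 * Real.pi / c))⁻¹ * (x ^ 2 * Real.exp (-(c / 2) * x ^ 2)) := by
    intro x
    rw [show -x ^ 2 / (2 * c⁻¹) = -(c / 2) * x ^ 2 by field_simp, ← div_eq_mul_inv]
    ring
  simp_rw [h2, integral_const_mul] at h1
  have : 0 < √(2 * Real.pi / c) := by positivity
  field_simp at h1 ⊢
  linarith

lemma exp_neg_sum_sq_eq_prod {ι : Type*} [Fintype ι] (c : ℝ) (w : ι → ℝ) :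
    Real.exp (-(c / 2) * ∑ i, w i ^ 2) = ∏ i, Real.exp (-(c / 2) * w i ^ 2) := by
  rw [← Real.exp_sum, Finset.mul_sum]

lemma integrable_exp_neg_sum_sq {ι : Type*} [Fintype ι] {c : ℝ} (hc : 0 < c) :
    Integrable fun w : ι → ℝ ↦ Real.exp (-(c / 2) * ∑ i, w i ^ 2) := by
  simp_rw [exp_neg_sum_sq_eq_prod]
  exact Integrable.fintype_prod (f := fun _ x ↦ Real.exp (-(c / 2) * x ^ 2))
    fun _ ↦ integrable_exp_neg_mul_sq (by positivity)

lemma integral_exp_neg_sum_sq {ι : Type*} [Fintype ι] (c : ℝ) :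
    ∫ w : ι → ℝ, Real.exp (-(c / 2) * ∑ i, w i ^ 2) =
      √(2 * Real.pi / c) ^ Fintype.card ι := by
  simp_rw [exp_neg_sum_sq_eq_prod]
  rw [integral_fintype_prod_volume_eq_prod fun _ x ↦ Real.exp (-(c / 2) * x ^ 2)]
  simp only [integral_gaussian, Finset.prod_const, Finset.card_univ]
  congr 2
  field_simp

lemma sq_mul_exp_neg_sum_sq_eq_prod {ι : Type*} [Fintype ι] [DecidableEq ι] (c : ℝ)
    (w : ι → ℝ) (j : ι) :
    w j ^ 2 * Real.exp (-(c / 2) * ∑ i, w i ^ 2) =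
      ∏ i, (if i = j then w i ^ 2 else 1) * Real.exp (-(c / 2) * w i ^ 2) := by
  rw [exp_neg_sum_sq_eq_prod, Finset.prod_mul_distrib]
  simp

lemma integrable_sq_mul_exp_neg_sum_sq {ι : Type*} [Fintype ι] {c : ℝ} (hc : 0 < c) (j : ι) :
    Integrable fun w : ι → ℝ ↦ w j ^ 2 * Real.exp (-(c / 2) * ∑ i, w i ^ 2) := by
  classical
  simp_rw [sq_mul_exp_neg_sum_sq_eq_prod]
  refine Integrable.fintype_prod
    (f := fun i x ↦ (if i = j then x ^ 2 else 1) * Real.exp (-(c / 2) * x ^ 2)) fun i ↦ ?_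
  by_cases h : i = j
  · simpa [h] using integrable_sq_mul_exp_neg hc
  · simpa [h] using integrable_exp_neg_mul_sq (b := c / 2) (by positivity)

lemma integral_sq_mul_exp_neg_sum_sq {ι : Type*} [Fintype ι] {c : ℝ} (hc : 0 < c) (j : ι) :
    ∫ w : ι → ℝ, w j ^ 2 * Real.exp (-(c / 2) * ∑ i, w i ^ 2) =
      √(2 * Real.pi / c) ^ Fintype.card ι / c := by
  classical
  simp_rw [sq_mul_exp_neg_sum_sq_eq_prod]
  rw [integral_fintype_prod_volume_eq_prod
    fun i x ↦ (if i = j then x ^ 2 else 1) * Real.exp (-(c / 2) * x ^ 2)]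
  have h : ∀ i, ∫ x : ℝ, (if i = j then x ^ 2 else 1) * Real.exp (-(c / 2) * x ^ 2) =
      (if i = j then c⁻¹ else 1) * √(2 * Real.pi / c) := by
    intro i
    by_cases h : i = j
    · simp only [h, if_true, integral_sq_mul_exp_neg hc]
      ring
    · simp only [h, if_false, one_mul, integral_gaussian]
      congr 1
      field_simp
  simp_rw [h, Finset.prod_mul_distrib]
  simp [div_eq_inv_mul]

lemma lintegral_sqrt_mul_exp_neg_sum_sq_le {ι : Type*} [Fintype ι] [Nonempty ι] {c : ℝ}
    (hc : 0 < c) :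
    ∫⁻ w : ι → ℝ, ENNReal.ofReal (√(∑ i, w i ^ 2) * Real.exp (-(c / 2) * ∑ i, w i ^ 2)) ≤
      ENNReal.ofReal (√(Fintype.card ι / c) * √(2 * Real.pi / c) ^ Fintype.card ι) := by
  set k := √(Fintype.card ι / c) with hk
  have hcard : (0 : ℝ) < Fintype.card ι := by exact_mod_cast Fintype.card_pos
  have hk0 : 0 < k := by positivity
  have hk2 : k ^ 2 = Fintype.card ι / c := Real.sq_sqrt (by positivity)
  have hsum : Integrable fun w : ι → ℝ ↦
      ∑ j, w j ^ 2 * Real.exp (-(c / 2) * ∑ i, w i ^ 2) :=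
    integrable_finsetSum _ fun j _ ↦ integrable_sq_mul_exp_neg_sum_sq hc j
  let g : (ι → ℝ) → ℝ := fun w ↦
    (2 * k)⁻¹ * ∑ j, w j ^ 2 * Real.exp (-(c / 2) * ∑ i, w i ^ 2) +
      k / 2 * Real.exp (-(c / 2) * ∑ i, w i ^ 2)
  have hg : Integrable g :=
    (hsum.const_mul _).add ((integrable_exp_neg_sum_sq hc).const_mul _)
  have hint : ∫ w, g w = k * √(2 * Real.pi / c) ^ Fintype.card ι := by
    rw [integral_add (hsum.const_mul _) ((integrable_exp_neg_sum_sq hc).const_mul _),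
      integral_const_mul, integral_const_mul,
      integral_finsetSum _ fun j _ ↦ integrable_sq_mul_exp_neg_sum_sq hc j]
    simp only [integral_sq_mul_exp_neg_sum_sq hc, integral_exp_neg_sum_sq, Finset.sum_const,
      Finset.card_univ, nsmul_eq_mul]
    rw [mul_div_left_comm, ← hk2]
    field_simp
    ring
  have hle : ∀ w : ι → ℝ, √(∑ i, w i ^ 2) * Real.exp (-(c / 2) * ∑ i, w i ^ 2) ≤ g w := by
    intro w
    have hS : 0 ≤ ∑ i, w i ^ 2 := by positivity
    simp only [g, ← Finset.sum_mul, ← mul_assoc, ← add_mul]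
    refine mul_le_mul_of_nonneg_right ?_ (Real.exp_nonneg _)
    have h := sq_nonneg (√(∑ i, w i ^ 2) - k)
    rw [sub_sq, Real.sq_sqrt hS] at h
    rw [inv_mul_eq_div, div_add_div _ _ (by positivity) two_ne_zero, le_div_iff₀ (by positivity)]
    linarith
  calc _ ≤ ∫⁻ w, ENNReal.ofReal (g w) :=
        lintegral_mono fun w ↦ ENNReal.ofReal_le_ofReal (hle w)
    _ = ENNReal.ofReal (∫ w, g w) :=
        (ofReal_integral_eq_lintegral_ofReal hg <| ae_of_all _ fun w ↦
          le_trans (by positivity) (hle w)).symm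
    _ = _ := by rw [hint]

lemma hasDerivAt_mul_div_sqrt_one_sub_sq (r : ℝ) {t : ℝ} (ht : t ∈ Set.Ioo (-1 : ℝ) 1) :
    HasDerivAt (fun t ↦ t * r / √(1 - t ^ 2)) (r / √(1 - t ^ 2) ^ 3) t := by
  have h : 0 < 1 - t ^ 2 := by nlinarith [ht.1, ht.2]
  have hs : 0 < √(1 - t ^ 2) := by positivity
  have hsq := Real.sq_sqrt h.le
  have h1 : HasDerivAt (fun t : ℝ ↦ 1 - t ^ 2) (-(2 * t)) t := by
    simpa using (hasDerivAt_pow 2 t).const_sub 1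
  refine (((hasDerivAt_id t).mul_const r).fun_div (h1.sqrt h.ne') hs.ne').congr_deriv ?_
  rw [id]
  field_simp
  linear_combination r * hsq

lemma div_sqrt_sq_add_sq_mem_Ioo {r : ℝ} (hr : 0 < r) (s : ℝ) :
    s / √(s ^ 2 + r ^ 2) ∈ Set.Ioo (-1 : ℝ) 1 := by
  rw [Set.mem_Ioo, ← abs_lt, abs_div, abs_of_nonneg (Real.sqrt_nonneg _),
    div_lt_one (by positivity)]
  exact Real.lt_sqrt_of_sq_lt (by rw [sq_abs]; nlinarith)

lemma mul_div_sqrt_one_sub_sq_div_sqrt {r : ℝ} (hr : 0 < r) (s : ℝ) :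
    s / √(s ^ 2 + r ^ 2) * r / √(1 - (s / √(s ^ 2 + r ^ 2)) ^ 2) = s := by
  have h : 0 < s ^ 2 + r ^ 2 := by positivity
  have h1 : 1 - (s / √(s ^ 2 + r ^ 2)) ^ 2 = (r / √(s ^ 2 + r ^ 2)) ^ 2 := by
    rw [div_pow, div_pow, Real.sq_sqrt h.le]
    field_simp
    ring
  rw [h1, Real.sqrt_sq (by positivity)]
  field_simp

lemma div_sqrt_sq_add_sq_mul_div_sqrt {r : ℝ} (hr : 0 < r) {t : ℝ}
    (ht : t ∈ Set.Ioo (-1 : ℝ) 1) :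
    t * r / √(1 - t ^ 2) / √((t * r / √(1 - t ^ 2)) ^ 2 + r ^ 2) = t := by
  have h : 0 < 1 - t ^ 2 := by nlinarith [ht.1, ht.2]
  have h1 : (t * r / √(1 - t ^ 2)) ^ 2 + r ^ 2 = (r / √(1 - t ^ 2)) ^ 2 := by
    rw [div_pow, div_pow, Real.sq_sqrt h.le]
    field_simp
    ring
  rw [h1, Real.sqrt_sq (by positivity)]
  field_simp

lemma setLIntegral_exp_neg_sq_cosine {r : ℝ} (hr : 0 < r) (a b : ℝ) :
    ∫⁻ s in {s : ℝ | s / √(s ^ 2 + r ^ 2) ∈ Set.Icc a b},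
        ENNReal.ofReal (Real.exp (-(1 / 2) * (s ^ 2 + r ^ 2))) =
      ∫⁻ t in Set.Icc a b ∩ Set.Ioo (-1) 1,
        ENNReal.ofReal (r / √(1 - t ^ 2) ^ 3 * Real.exp (-((1 - t ^ 2)⁻¹ / 2) * r ^ 2)) := by
  have himage : {s : ℝ | s / √(s ^ 2 + r ^ 2) ∈ Set.Icc a b} =
      (fun t ↦ t * r / √(1 - t ^ 2)) '' (Set.Icc a b ∩ Set.Ioo (-1) 1) := by
    ext s
    constructor
    · intro hs
      exact ⟨_, ⟨hs, div_sqrt_sq_add_sq_mem_Ioo hr s⟩, mul_div_sqrt_one_sub_sq_div_sqrt hr s⟩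
    · rintro ⟨t, ⟨ht, ht1⟩, rfl⟩
      simpa only [Set.mem_ofPred_eq, div_sqrt_sq_add_sq_mul_div_sqrt hr ht1] using ht
  have hinj : Set.InjOn (fun t ↦ t * r / √(1 - t ^ 2)) (Set.Icc a b ∩ Set.Ioo (-1) 1) :=
    Set.LeftInvOn.injOn (f₁' := fun s ↦ s / √(s ^ 2 + r ^ 2))
      fun t ht ↦ div_sqrt_sq_add_sq_mul_div_sqrt hr ht.2
  have hmeas : MeasurableSet (Set.Icc a b ∩ Set.Ioo (-1) 1) :=
    measurableSet_Icc.inter measurableSet_Ioo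
  rw [himage, lintegral_image_eq_lintegral_abs_deriv_mul hmeas
    (fun t ht ↦ (hasDerivAt_mul_div_sqrt_one_sub_sq r ht.2).hasDerivWithinAt) hinj]
  refine setLIntegral_congr_fun hmeas fun t ht ↦ ?_
  have h : 0 < 1 - t ^ 2 := by nlinarith [ht.2.1, ht.2.2]
  have hpos : 0 ≤ r / √(1 - t ^ 2) ^ 3 := by positivity
  rw [abs_of_nonneg hpos, ← ENNReal.ofReal_mul hpos]
  congr 3
  rw [div_pow, Real.sq_sqrt h.le]
  field_simp
  ring

lemma lintegral_cosine_density_le {n : ℕ} (hn : 2 ≤ n) {t : ℝ} (ht : t ∈ Set.Ioo (-1 : ℝ) 1) :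
    ∫⁻ w : Fin n → ℝ, ENNReal.ofReal (√(∑ i, w i ^ 2) / √(1 - t ^ 2) ^ 3 *
        Real.exp (-((1 - t ^ 2)⁻¹ / 2) * √(∑ i, w i ^ 2) ^ 2)) ≤
      ENNReal.ofReal (√n * √(2 * Real.pi) ^ n) := by
  have h : 0 < 1 - t ^ 2 := by nlinarith [ht.1, ht.2]
  have : Nonempty (Fin n) := ⟨0, by omega⟩
  set q := √(1 - t ^ 2) with hq
  have hq0 : 0 < q := by positivity
  have hq1 : q ≤ 1 := by
    rw [hq, Real.sqrt_le_one]
    nlinarith [sq_nonneg t]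
  have hrw : ∀ w : Fin n → ℝ, ENNReal.ofReal (√(∑ i, w i ^ 2) / q ^ 3 *
        Real.exp (-((1 - t ^ 2)⁻¹ / 2) * √(∑ i, w i ^ 2) ^ 2)) =
      ENNReal.ofReal (q ^ 3)⁻¹ * ENNReal.ofReal (√(∑ i, w i ^ 2) *
        Real.exp (-((1 - t ^ 2)⁻¹ / 2) * ∑ i, w i ^ 2)) := by
    intro w
    rw [← ENNReal.ofReal_mul (by positivity), Real.sq_sqrt (by positivity)]
    congr 1
    ring
  simp_rw [hrw]
  rw [lintegral_const_mul _ (by fun_prop)]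
  refine (mul_le_mul_right (lintegral_sqrt_mul_exp_neg_sum_sq_le (inv_pos.mpr h)) _).trans ?_
  rw [← ENNReal.ofReal_mul (by positivity)]
  refine ENNReal.ofReal_le_ofReal ?_
  obtain ⟨m, rfl⟩ := Nat.exists_eq_add_of_le' hn
  simp only [Fintype.card_fin, div_inv_eq_mul]
  rw [Real.sqrt_mul (by positivity), Real.sqrt_mul (by positivity), ← hq]
  calc (q ^ 3)⁻¹ * (√((m + 2 : ℕ) : ℝ) * q * (√(2 * Real.pi) * q) ^ (m + 2))
      = √((m + 2 : ℕ) : ℝ) * √(2 * Real.pi) ^ (m + 2) * q ^ m := by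
        field_simp
        ring
    _ ≤ _ := mul_le_of_le_one_right (by positivity) (pow_le_one₀ hq0.le hq1)

lemma measurePreserving_toLp_cons (n : ℕ) :
    MeasurePreserving fun p : ℝ × (Fin n → ℝ) ↦
      (WithLp.toLp 2 (Fin.cons p.1 p.2 : Fin (n + 1) → ℝ) : EuclideanSpace ℝ (Fin (n + 1))) := by
  convert! (PiLp.volume_preserving_toLp (Fin (n + 1))).comp
    (volume_preserving_piFinSuccAbove (fun _ ↦ ℝ) 0).symm using 3 with p
  simp [MeasurableEquiv.piFinSuccAbove_symm_apply, Fin.consEquiv]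

lemma setLIntegral_exp_neg_norm_sq_cosine_zero_le {n : ℕ} (hn : 2 ≤ n) (a b : ℝ) :
    ∫⁻ y in {y : EuclideanSpace ℝ (Fin (n + 1)) | y 0 / ‖y‖ ∈ Set.Icc a b},
        ENNReal.ofReal (Real.exp (-(1 / 2) * ‖y‖ ^ 2)) ≤
      ENNReal.ofReal (√n * √(2 * Real.pi) ^ n) * ENNReal.ofReal (b - a) := by
  have : Nonempty (Fin n) := ⟨0, by omega⟩
  let r : (Fin n → ℝ) → ℝ := fun w ↦ √(∑ i, w i ^ 2)
  have hr : Measurable r := by fun_prop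
  let J := Set.Icc a b ∩ Set.Ioo (-1 : ℝ) 1
  let S := {p : ℝ × (Fin n → ℝ) | p.1 / √(p.1 ^ 2 + r p.2 ^ 2) ∈ Set.Icc a b}
  have hS : MeasurableSet S := measurableSet_Icc.preimage (by fun_prop)
  have hJ : MeasurableSet J := measurableSet_Icc.inter measurableSet_Ioo
  have hnorm : ∀ p : ℝ × (Fin n → ℝ),
      ‖(WithLp.toLp 2 (Fin.cons p.1 p.2 : Fin (n + 1) → ℝ) : EuclideanSpace ℝ (Fin (n + 1)))‖ =
        √(p.1 ^ 2 + r p.2 ^ 2) := by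
    intro p
    rw [Real.sq_sqrt (by positivity), EuclideanSpace.norm_eq, Fin.sum_univ_succ]
    simp
  have hA : MeasurableSet {y : EuclideanSpace ℝ (Fin (n + 1)) | y 0 / ‖y‖ ∈ Set.Icc a b} :=
    measurableSet_Icc.preimage (by fun_prop)
  calc _ = ∫⁻ p in S, ENNReal.ofReal (Real.exp (-(1 / 2) * (p.1 ^ 2 + r p.2 ^ 2))) := by
        rw [← (measurePreserving_toLp_cons n).setLIntegral_comp_preimage hA (by fun_prop)]
        simp only [hnorm, Set.preimage_ofPred_eq, Fin.cons_zero]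
        refine setLIntegral_congr_fun hS fun p _ ↦ ?_
        simp only [Real.sq_sqrt (add_nonneg (sq_nonneg p.1) (sq_nonneg (r p.2)))]
    _ = ∫⁻ w : Fin n → ℝ, ∫⁻ s in {s : ℝ | s / √(s ^ 2 + r w ^ 2) ∈ Set.Icc a b},
          ENNReal.ofReal (Real.exp (-(1 / 2) * (s ^ 2 + r w ^ 2))) := by
        rw [← lintegral_indicator hS, Measure.volume_eq_prod, lintegral_prod_symm' _
          (Measurable.indicator (by fun_prop) hS)]
        refine lintegral_congr fun w ↦ ?_
        have hm : MeasurableSet {s : ℝ | s / √(s ^ 2 + r w ^ 2) ∈ Set.Icc a b} :=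
          measurableSet_Icc.preimage (by fun_prop)
        rw [← lintegral_indicator hm]
        rfl
    _ = ∫⁻ w : Fin n → ℝ, ∫⁻ t in J, ENNReal.ofReal
          (r w / √(1 - t ^ 2) ^ 3 * Real.exp (-((1 - t ^ 2)⁻¹ / 2) * r w ^ 2)) := by
        refine lintegral_congr_ae ?_
        filter_upwards [Measure.ae_ne volume (0 : Fin n → ℝ)] with w hw
        refine setLIntegral_exp_neg_sq_cosine (Real.sqrt_pos.mpr ?_) a b
        obtain ⟨i, hi⟩ := Function.ne_iff.mp hw
        exact Finset.sum_pos' (fun _ _ ↦ sq_nonneg _) ⟨i, Finset.mem_univ i, sq_pos_of_ne_zero hi⟩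
    _ = ∫⁻ t in J, ∫⁻ w : Fin n → ℝ, ENNReal.ofReal
          (r w / √(1 - t ^ 2) ^ 3 * Real.exp (-((1 - t ^ 2)⁻¹ / 2) * r w ^ 2)) :=
        lintegral_lintegral_swap (by unfold Function.uncurry; fun_prop)
    _ ≤ ∫⁻ _ in J, ENNReal.ofReal (√n * √(2 * Real.pi) ^ n) :=
        setLIntegral_mono' hJ fun t ht ↦ lintegral_cosine_density_le hn ht.2
    _ ≤ _ := by
        rw [setLIntegral_const, ← Real.volume_Icc]
        gcongr
        exact Set.inter_subset_left

lemma exists_linearIsometryEquiv_apply_eq {E : Type*} [NormedAddCommGroup E]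
    [InnerProductSpace ℝ E] {u v : E} (h : ‖u‖ = ‖v‖) : ∃ g : E ≃ₗᵢ[ℝ] E, g u = v :=
  ⟨_, Submodule.reflection_sub h⟩

lemma setLIntegral_exp_neg_norm_sq_cosine_le {n : ℕ} (hn : 2 ≤ n) (a b : ℝ)
    {x : EuclideanSpace ℝ (Fin (n + 1))} (hx : ‖x‖ = 1) :
    ∫⁻ y in {y | ⟪y, x⟫ / ‖y‖ ∈ Set.Icc a b}, ENNReal.ofReal (Real.exp (-(1 / 2) * ‖y‖ ^ 2)) ≤
      ENNReal.ofReal (√n * √(2 * Real.pi) ^ n) * ENNReal.ofReal (b - a) := by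
  obtain ⟨g, hg⟩ := exists_linearIsometryEquiv_apply_eq
    (u := EuclideanSpace.single (0 : Fin (n + 1)) (1 : ℝ)) (v := x) (by simp [hx])
  have hpre : g ⁻¹' {y | ⟪y, x⟫ / ‖y‖ ∈ Set.Icc a b} =
      {y : EuclideanSpace ℝ (Fin (n + 1)) | y 0 / ‖y‖ ∈ Set.Icc a b} := by
    ext y
    simp [← hg, EuclideanSpace.inner_single_right]
  have hm : MeasurableSet {y | ⟪y, x⟫ / ‖y‖ ∈ Set.Icc a b} :=
    measurableSet_Icc.preimage (by fun_prop)
  rw [← g.measurePreserving.setLIntegral_comp_preimage hm (by fun_prop), hpre]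
  simpa using setLIntegral_exp_neg_norm_sq_cosine_zero_le hn a b

lemma lintegral_exp_neg_norm_sq (n : ℕ) :
    ∫⁻ y : EuclideanSpace ℝ (Fin n), ENNReal.ofReal (Real.exp (-(1 / 2) * ‖y‖ ^ 2)) =
      ENNReal.ofReal (√(2 * Real.pi) ^ n) := by
  rw [← (PiLp.volume_preserving_toLp (Fin n)).lintegral_comp (by fun_prop)]
  simp only [EuclideanSpace.norm_sq_eq, Real.norm_eq_abs, sq_abs]
  rw [← ofReal_integral_eq_lintegral_ofReal (integrable_exp_neg_sum_sq one_pos)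
    (ae_of_all _ fun _ ↦ Real.exp_nonneg _), integral_exp_neg_sum_sq]
  simp

/-- A marginal of a rotation-invariant probability measure on the unit sphere of `ℝ^(n+1)` has
density at most `√(n / (2π))`. -/
lemma measure_inner_mem_Icc_le {n : ℕ} (hn : 2 ≤ n)
    (ν : Measure (EuclideanSpace ℝ (Fin (n + 1)))) [IsProbabilityMeasure ν]
    (hsphere : ∀ᵐ x ∂ν, ‖x‖ = 1)
    (hinv : ∀ g : EuclideanSpace ℝ (Fin (n + 1)) ≃ₗᵢ[ℝ] EuclideanSpace ℝ (Fin (n + 1)),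
      MeasurePreserving g ν ν)
    {u : EuclideanSpace ℝ (Fin (n + 1))} (hu : ‖u‖ = 1) (a b : ℝ) :
    ν {x | ⟪u, x⟫ ∈ Set.Icc a b} ≤ ENNReal.ofReal (√(n / (2 * Real.pi)) * (b - a)) := by
  let E := EuclideanSpace ℝ (Fin (n + 1))
  let D : E → ENNReal := fun y ↦ ENNReal.ofReal (Real.exp (-(1 / 2) * ‖y‖ ^ 2))
  let A : Set (E × E) := {p | ⟪p.1, p.2⟫ / ‖p.1‖ ∈ Set.Icc a b}
  have hA : MeasurableSet A := measurableSet_Icc.preimage (by fun_prop)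
  have hD : Measurable D := by fun_prop
  have hslice : ∀ y : E, y ≠ 0 →
      ν {x | (y, x) ∈ A} = ν {x | ⟪u, x⟫ ∈ Set.Icc a b} := by
    intro y hy
    obtain ⟨g, hg⟩ := exists_linearIsometryEquiv_apply_eq (u := u) (v := ‖y‖⁻¹ • y)
      (by rw [hu, norm_smul, norm_inv, norm_norm, inv_mul_cancel₀ (norm_ne_zero_iff.mpr hy)])
    have hpre : g ⁻¹' {x | (y, x) ∈ A} = {x | ⟪u, x⟫ ∈ Set.Icc a b} := by
      ext x
      change ⟪y, g x⟫ / ‖y‖ ∈ Set.Icc a b ↔ ⟪u, x⟫ ∈ Set.Icc a b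
      rw [← g.inner_map_map u x, hg, real_inner_smul_left, div_eq_inv_mul]
    have hm : MeasurableSet {x | (y, x) ∈ A} := hA.preimage measurable_prodMk_left
    rw [← hpre, (hinv g).measure_preimage hm.nullMeasurableSet]
  have key : ν {x | ⟪u, x⟫ ∈ Set.Icc a b} * ENNReal.ofReal (√(2 * Real.pi) ^ (n + 1)) ≤
      ENNReal.ofReal (√n * √(2 * Real.pi) ^ n) * ENNReal.ofReal (b - a) := by
    calc _ = ∫⁻ y : E, ν {x | ⟪u, x⟫ ∈ Set.Icc a b} * D y := by
          rw [lintegral_const_mul _ hD, lintegral_exp_neg_norm_sq]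
      _ = ∫⁻ y : E, ∫⁻ x, A.indicator (fun p ↦ D p.1) (y, x) ∂ν := by
          refine lintegral_congr_ae ?_
          filter_upwards [Measure.ae_ne volume (0 : E)] with y hy
          have hm : MeasurableSet {x | (y, x) ∈ A} := hA.preimage measurable_prodMk_left
          rw [← hslice y hy, mul_comm, ← setLIntegral_const, ← lintegral_indicator hm]
          rfl
      _ = ∫⁻ x, (∫⁻ y : E, A.indicator (fun p ↦ D p.1) (y, x)) ∂ν :=
          lintegral_lintegral_swap (f := fun y x ↦ A.indicator (fun p ↦ D p.1) (y, x))
            ((hD.comp measurable_fst).indicator hA).aemeasurable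
      _ ≤ ∫⁻ _, ENNReal.ofReal (√n * √(2 * Real.pi) ^ n) * ENNReal.ofReal (b - a) ∂ν := by
          refine lintegral_mono_ae ?_
          filter_upwards [hsphere] with x hx
          refine le_trans (le_of_eq ?_) (setLIntegral_exp_neg_norm_sq_cosine_le hn a b hx)
          have hm : MeasurableSet {y | ⟪y, x⟫ / ‖y‖ ∈ Set.Icc a b} :=
            measurableSet_Icc.preimage (by fun_prop)
          rw [← lintegral_indicator hm]
          rfl
      _ = _ := by simp
  have hpos : 0 < √(2 * Real.pi) ^ (n + 1) := by positivity
  rw [← ENNReal.le_div_iff_mul_le (Or.inl (ENNReal.ofReal_pos.mpr hpos).ne')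
      (Or.inl ENNReal.ofReal_ne_top),
    ← ENNReal.ofReal_mul (by positivity), ← ENNReal.ofReal_div_of_pos hpos] at key
  convert key using 2
  rw [Real.sqrt_div (by positivity)]
  field_simp
  ring

lemma measurePreserving_smul_hausdorffMeasure_restrict_sphere {E : Type*} [NormedAddCommGroup E]
    [NormedSpace ℝ E] [MeasurableSpace E] [BorelSpace E] (k : ENNReal) (s r : ℝ)
    (g : E ≃ₗᵢ[ℝ] E) :
    MeasurePreserving g (k • (μH[s]).restrict (Metric.sphere (0 : E) r))
      (k • (μH[s]).restrict (Metric.sphere (0 : E) r)) := by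
  have h := (g.toIsometryEquiv.measurePreserving_hausdorffMeasure s).restrict_preimage
    (s := Metric.sphere (0 : E) r) Metric.isClosed_sphere.measurableSet
  have hpre : g.toIsometryEquiv ⁻¹' Metric.sphere (0 : E) r = Metric.sphere (0 : E) r := by
    ext x
    simp
  rw [hpre] at h
  exact h.smul_measure k

/-- Concentration inequality for the random perturbation (Lemma `concentration_xi`):
if `ξ = σ·e·ξ̄` with `ξ̄` uniform on the unit sphere of `ℝ^d` (`d ≥ 3`) and
`e ∈ {±1}` an arbitrary (possibly `ξ̄`-dependent) sign, then with probability at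
least `1 - δ` we have `|⟨z, ξ⟩ + c| ≥ δ‖z‖σ√(π/(8d))`. -/
theorem perturbation_concentration
    {d : ℕ} (hd : 3 ≤ d)
    (z : EuclideanSpace ℝ (Fin d)) (c δ σ : ℝ)
    (hδ0 : 0 < δ) (hδ1 : δ < 1) (hσ : 0 < σ)
    {Ω : Type*} [MeasurableSpace Ω] (P : Measure Ω) [IsProbabilityMeasure P]
    (ξbar : Ω → EuclideanSpace ℝ (Fin d)) (hξbar : Measurable ξbar)
    (hdist : Measure.map ξbar P =
      (μH[(d : ℝ) - 1] (Metric.sphere (0 : EuclideanSpace ℝ (Fin d)) 1))⁻¹ •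
        (μH[(d : ℝ) - 1]).restrict (Metric.sphere (0 : EuclideanSpace ℝ (Fin d)) 1))
    (e : Ω → ℝ) (he : ∀ ω, e ω = 1 ∨ e ω = -1) (hemeas : Measurable e)
    (ξ : Ω → EuclideanSpace ℝ (Fin d)) (hξ : ∀ ω, ξ ω = (σ * e ω) • ξbar ω) :
    ENNReal.ofReal (1 - δ) ≤
      P {ω | δ * ‖z‖ * σ * Real.sqrt (Real.pi / (8 * d)) ≤ |⟪z, ξ ω⟫ + c|} := by
  obtain rfl | hz := eq_or_ne z 0
  · simp [hδ0.le]
  obtain ⟨n, rfl⟩ := Nat.exists_eq_add_of_le' (show 1 ≤ d by omega)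
  have hn : 2 ≤ n := by omega
  have hz0 : 0 < ‖z‖ := norm_pos_iff.mpr hz
  set ν := Measure.map ξbar P
  have : IsProbabilityMeasure ν := Measure.isProbabilityMeasure_map hξbar.aemeasurable
  have hsphere : ∀ᵐ x ∂ν, ‖x‖ = 1 := by
    rw [hdist]
    refine Measure.ae_smul_measure ?_ _
    filter_upwards [ae_restrict_mem Metric.isClosed_sphere.measurableSet] with x hx
    simpa using hx
  have hinv (g : EuclideanSpace ℝ (Fin (n + 1)) ≃ₗᵢ[ℝ] EuclideanSpace ℝ (Fin (n + 1))) :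
      MeasurePreserving g ν ν := by
    rw [hdist]
    exact measurePreserving_smul_hausdorffMeasure_restrict_sphere _ _ _ g
  set u := ‖z‖⁻¹ • z with hu_def
  have hu : ‖u‖ = 1 := norm_smul_inv_norm (𝕜 := ℝ) hz
  have hzu (x) : ⟪z, x⟫ = ‖z‖ * ⟪u, x⟫ := by
    rw [hu_def, real_inner_smul_left, mul_inv_cancel_left₀ hz0.ne']
  set k := c / (σ * ‖z‖) with hk
  set h := δ * √(Real.pi / (8 * (n + 1 : ℕ))) with hh
  have hstrip (a : ℝ) :
      P (ξbar ⁻¹' {x | ⟪u, x⟫ ∈ Set.Icc (a - h) (a + h)}) ≤ ENNReal.ofReal (δ / 2) := by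
    have hm : MeasurableSet {x | ⟪u, x⟫ ∈ Set.Icc (a - h) (a + h)} :=
      measurableSet_Icc.preimage (by fun_prop)
    rw [← Measure.map_apply hξbar hm]
    refine (measure_inner_mem_Icc_le hn ν hsphere hinv hu _ _).trans
      (ENNReal.ofReal_le_ofReal ?_)
    have hsqrt : √(n / (2 * Real.pi)) * √(Real.pi / (8 * (n + 1 : ℕ))) ≤ 1 / 4 := by
      rw [← Real.sqrt_mul (by positivity), Real.sqrt_le_left (by norm_num)]
      push_cast
      field_simp
      linarith
    calc _ = 2 * δ * (√(n / (2 * Real.pi)) * √(Real.pi / (8 * (n + 1 : ℕ)))) := by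
          rw [hh]
          ring
      _ ≤ 2 * δ * (1 / 4) := by gcongr
      _ = δ / 2 := by ring
  set good := {ω | δ * ‖z‖ * σ * √(Real.pi / (8 * (n + 1 : ℕ))) ≤ |⟪z, ξ ω⟫ + c|} with hgood
  have hcover : Set.univ ⊆ good ∪ (ξbar ⁻¹' {x | ⟪u, x⟫ ∈ Set.Icc (-k - h) (-k + h)} ∪
      ξbar ⁻¹' {x | ⟪u, x⟫ ∈ Set.Icc (k - h) (k + h)}) := by
    intro ω _
    by_cases hω : ω ∈ good
    · exact Or.inl hω
    right
    have hlt : |e ω * ⟪u, ξbar ω⟫ + k| < h := by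
      have heq : ⟪z, ξ ω⟫ + c = σ * ‖z‖ * (e ω * ⟪u, ξbar ω⟫ + k) := by
        rw [hξ, real_inner_smul_right, hzu, hk]
        field_simp
      rw [hgood, Set.mem_ofPred_eq, not_le, heq, abs_mul, abs_of_pos (by positivity)] at hω
      refine lt_of_mul_lt_mul_left (hω.trans_eq ?_) (show 0 ≤ σ * ‖z‖ by positivity)
      rw [hh]
      ring
    rw [abs_lt] at hlt
    rcases he ω with h1 | h1 <;> rw [h1] at hlt
    · left
      constructor <;> linarith
    · right
      constructor <;> linarith
  have htotal : 1 ≤ P good + ENNReal.ofReal δ := by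
    calc 1 = P Set.univ := measure_univ.symm
      _ ≤ P good + (ENNReal.ofReal (δ / 2) + ENNReal.ofReal (δ / 2)) :=
        (measure_mono hcover).trans <| (measure_union_le _ _).trans <|
          add_le_add le_rfl <| (measure_union_le _ _).trans <|
            add_le_add (hstrip _) (hstrip _)
      _ = P good + ENNReal.ofReal δ := by
        rw [← ENNReal.ofReal_add (by positivity) (by positivity), add_halves]
  rw [ENNReal.ofReal_sub _ hδ0.le, ENNReal.ofReal_one]
  exact tsub_le_iff_right.mpr htotal
end
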